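/- Let A be a unital C*-algebra and \Delta \in A a positive invertible element. For t \in \mathbb{R}, let \Delta^{it} denote the element obtained from \Delta by the continuous functional calculus applied to z \mapsto \exp(i t \log z) (well-defined and unitary since the spectrum of \Delta lies in (0,\infty)). Then for every s \in \mathbb{R}, the Bochner integral \int_{\mathbb{R}} \frac{2 e^{-ist}}{e^{\pi t} + e^{-\pi t}} \, \Delta^{it} \, dt exists in A and equals 2 e^{s/2} \, \Delta^{1/2} (\Delta + e^{s} \cdot 1)^{-1}, where \Delta^{1/2} is the positive square root of \Delta and \Delta + e^s \cdot 1 is invertible. -/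

import Mathlib

open MeasureTheory Real

/-- The logistic substitution `x = (1 + e^{-2πt})⁻¹` turns the integrand of the Beta integral
`B(1/2 + ic/2π, 1/2 - ic/2π)` into the Fourier kernel of the hyperbolic secant. -/
lemma sigmoid_substitution_betaIntegrand (c t : ℝ) :
    |Real.sigmoid (2 * π * t) * (1 - Real.sigmoid (2 * π * t)) * (2 * π)| •
      ((Real.sigmoid (2 * π * t) : ℂ) ^ ((1 / 2 + c / (2 * π) * Complex.I : ℂ) - 1) *
        (1 - Real.sigmoid (2 * π * t) : ℂ) ^ ((1 - (1 / 2 + c / (2 * π) * Complex.I) : ℂ) - 1)) =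
    π * (2 * Complex.exp (Complex.I * c * t) /
      ((Real.exp (π * t) + Real.exp (-(π * t)) : ℝ) : ℂ)) := by
  have hπ : (π : ℂ) ≠ 0 := by exact_mod_cast Real.pi_ne_zero
  have hx := Real.sigmoid_pos (2 * π * t)
  have hy : 0 < 1 - Real.sigmoid (2 * π * t) := sub_pos.2 (Real.sigmoid_lt_one _)
  have hxy : Real.sigmoid (2 * π * t) * Real.exp (-(2 * π * t)) =
      1 - Real.sigmoid (2 * π * t) := by
    rw [Real.sigmoid_mul_rexp_neg, Real.sigmoid_neg]
  have hlog : Real.log (1 - Real.sigmoid (2 * π * t)) =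
      Real.log (Real.sigmoid (2 * π * t)) - 2 * π * t := by
    rw [← hxy, Real.log_mul hx.ne' (Real.exp_pos _).ne', Real.log_exp, sub_eq_add_neg]
  rw [abs_of_pos (by positivity)]
  have hden : ((Real.exp (π * t) + Real.exp (-(π * t)) : ℝ) : ℂ)⁻¹ =
      (1 - Real.sigmoid (2 * π * t) : ℝ) * Complex.exp (π * t) := by
    have : (Real.exp (π * t) + Real.exp (-(π * t)))⁻¹ =
        (1 - Real.sigmoid (2 * π * t)) * Real.exp (π * t) := by
      have h2 : Real.exp (2 * π * t) = Real.exp (π * t) * Real.exp (π * t) := by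
        rw [← Real.exp_add]; ring_nf
      have := Real.exp_pos (π * t)
      rw [← Real.sigmoid_neg, Real.sigmoid_def, neg_neg, h2, Real.exp_neg]
      field_simp
      ring
    rw [← Complex.ofReal_inv, this]
    push_cast
    ring
  rw [div_eq_mul_inv (2 * _), hden, ← Complex.ofReal_one, ← Complex.ofReal_sub]
  generalize Real.sigmoid (2 * π * t) = x at *
  generalize 1 - x = y at *
  have hx0 : (x : ℂ) ≠ 0 := by exact_mod_cast hx.ne'
  have hy0 : (y : ℂ) ≠ 0 := by exact_mod_cast hy.ne'
  rw [Complex.cpow_def_of_ne_zero hx0, Complex.cpow_def_of_ne_zero hy0, ← Complex.ofReal_log hx.le,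
    ← Complex.ofReal_log hy.le, hlog]
  have hxe : (x : ℂ) = Complex.exp (Real.log x) := by
    rw [← Complex.ofReal_exp, Real.exp_log hx]
  generalize Real.log x = a at *
  rw [Complex.real_smul]
  push_cast
  rw [hxe]
  calc _ = 2 * π * y * (Complex.exp a * (Complex.exp (a * (1 / 2 + c / (2 * π) * Complex.I - 1)) *
        Complex.exp ((a - 2 * π * t) * (1 - (1 / 2 + c / (2 * π) * Complex.I) - 1)))) := by ring
    _ = 2 * π * y * (Complex.exp (Complex.I * c * t) * Complex.exp (π * t)) := by
      rw [← Complex.exp_add, ← Complex.exp_add, ← Complex.exp_add]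
      congr 2
      field_simp
      ring
    _ = _ := by ring

/-- The Fourier transform of the hyperbolic secant. -/
lemma integral_exp_div_exp_add_exp (c : ℝ) :
    Integrable (fun t : ℝ => 2 * Complex.exp (Complex.I * c * t) /
      ((Real.exp (π * t) + Real.exp (-(π * t)) : ℝ) : ℂ)) ∧
    ∫ t : ℝ, 2 * Complex.exp (Complex.I * c * t) /
      ((Real.exp (π * t) + Real.exp (-(π * t)) : ℝ) : ℂ) = (Complex.cosh (c / 2))⁻¹ := by
  have hπ : (π : ℂ) ≠ 0 := by exact_mod_cast Real.pi_ne_zero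
  set u : ℂ := 1 / 2 + c / (2 * π) * Complex.I with hu
  have hre : (c / (2 * π) * Complex.I : ℂ).re = 0 := by
    rw [show (c / (2 * π) * Complex.I : ℂ) = ((c / (2 * π) : ℝ) : ℂ) * Complex.I by push_cast; rfl]
    exact Complex.re_ofReal_mul _ _ |>.trans (by simp)
  have hu0 : 0 < u.re := by rw [hu, Complex.add_re, hre]; norm_num
  have hu1 : 0 < (1 - u).re := by rw [hu, Complex.sub_re, Complex.add_re, hre]; norm_num
  let g : ℝ → ℂ := fun x => (x : ℂ) ^ (u - 1) * (1 - x : ℂ) ^ ((1 - u) - 1)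
  have hderiv : ∀ t ∈ (Set.univ : Set ℝ), HasDerivWithinAt (fun t => Real.sigmoid (2 * π * t))
      (Real.sigmoid (2 * π * t) * (1 - Real.sigmoid (2 * π * t)) * (2 * π)) Set.univ t := by
    intro t _
    exact ((Real.hasDerivAt_sigmoid _).comp t
      (by simpa using (hasDerivAt_id t).const_mul (2 * π))).hasDerivWithinAt
  have hinj : Set.InjOn (fun t => Real.sigmoid (2 * π * t)) Set.univ := by
    intro t _ t' _ h
    exact mul_left_cancel₀ Real.two_pi_pos.ne' (Real.sigmoid_injective h)
  have himage : (fun t => Real.sigmoid (2 * π * t)) '' Set.univ = Set.Ioo 0 1 := by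
    rw [Set.image_univ, ← Real.range_sigmoid]
    exact (mul_left_surjective₀ Real.two_pi_pos.ne').range_comp Real.sigmoid
  have hint := integrableOn_image_iff_integrableOn_abs_deriv_smul MeasurableSet.univ hderiv hinj g
  have heq := integral_image_eq_integral_abs_deriv_smul MeasurableSet.univ hderiv hinj g
  simp only [g, sigmoid_substitution_betaIntegrand, himage, hu] at hint heq
  rw [← hu] at hint heq
  rw [integrableOn_univ, integrable_const_mul_iff hπ.isUnit] at hint
  rw [Measure.restrict_univ, integral_const_mul, ← integral_Ioc_eq_integral_Ioo,
    ← intervalIntegral.integral_of_le zero_le_one] at heq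
  have hconv := Complex.betaIntegral_convergent hu0 hu1
  rw [intervalIntegrable_iff_integrableOn_Ioo_of_le zero_le_one] at hconv
  refine ⟨hint.1 hconv, ?_⟩
  have hbeta := Complex.Gamma_mul_Gamma_eq_betaIntegral hu0 hu1
  rw [add_sub_cancel, Complex.Gamma_one, one_mul, Complex.Gamma_mul_Gamma_one_sub,
    Complex.betaIntegral, heq] at hbeta
  have hsin : Complex.sin (π * u) = Complex.cosh (c / 2) := by
    rw [show π * u = c / 2 * Complex.I + π / 2 by rw [hu]; field_simp; ring,
      Complex.sin_add_pi_div_two, Complex.cos_mul_I]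
  rw [hsin, div_eq_mul_inv] at hbeta
  exact (mul_left_cancel₀ hπ hbeta).symm

lemma inv_cosh_log_sub_half (s : ℝ) {x : ℝ} (hx : 0 < x) :
    (Real.cosh ((Real.log x - s) / 2))⁻¹ =
      2 * Real.exp (s / 2) * (√x * (x + Real.exp s)⁻¹) := by
  have hsq : Real.exp (Real.log x / 2) = √x := by rw [Real.exp_half, Real.exp_log hx]
  have h₁ : Real.exp ((Real.log x - s) / 2) = √x / Real.exp (s / 2) := by
    rw [sub_div, Real.exp_sub, hsq]
  have h₂ : Real.exp s = Real.exp (s / 2) ^ 2 := by rw [← Real.exp_nat_mul]; ring_nf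
  have hs := Real.exp_pos (s / 2)
  have hr := Real.sqrt_pos.2 hx
  rw [Real.cosh_eq, Real.exp_neg, h₁, h₂]
  nth_rw 4 [← Real.sq_sqrt hx.le]
  field_simp

lemma exists_pos_of_mem_spectrum {A : Type*} [CStarAlgebra A] [PartialOrder A] [StarOrderedRing A]
    {a : A} (ha : 0 ≤ a) (hu : IsUnit a) {z : ℂ} (hz : z ∈ spectrum ℂ a) :
    ∃ x : ℝ, 0 < x ∧ z = x := by
  have hsa : IsSelfAdjoint a := .of_nonneg ha
  have hzr : z = z.re := hsa.mem_spectrum_eq_re hz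
  refine ⟨z.re, lt_of_le_of_ne ?_ ?_, hzr⟩
  · refine spectrum_nonneg_of_nonneg ha ?_
    rw [hzr] at hz
    exact (spectrum.algebraMap_mem_iff ℂ).1 hz
  · intro h
    rw [hzr, ← h, Complex.ofReal_zero] at hz
    exact spectrum.zero_notMem ℂ hu hz

/-- In a unital C*-algebra, for `Δ` positive and invertible, with `Δ^{it}` given by the
continuous functional calculus applied to `z ↦ exp(i t log z)`, the Bochner integral
`∫ 2 e^{-ist}/(e^{πt}+e^{-πt}) · Δ^{it} dt` exists and equals
`2 e^{s/2} · Δ^{1/2} (Δ + e^s·1)⁻¹`, where `Δ + e^s·1` is invertible. -/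
theorem stmt_2 (A : Type*) [CStarAlgebra A] [PartialOrder A] [StarOrderedRing A]
    (Δ : A) (hΔpos : 0 ≤ Δ) (hΔunit : IsUnit Δ) (s : ℝ) :
    Integrable (fun t : ℝ =>
      ((2 * Complex.exp (-(Complex.I * s * t))) /
        ((Real.exp (π * t) + Real.exp (-(π * t)) : ℝ) : ℂ)) •
        cfc (fun z : ℂ => Complex.exp (Complex.I * t * Complex.log z)) Δ) ∧
    IsUnit (Δ + (Real.exp s : ℂ) • (1 : A)) ∧
    (∫ t : ℝ, ((2 * Complex.exp (-(Complex.I * s * t))) /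
        ((Real.exp (π * t) + Real.exp (-(π * t)) : ℝ) : ℂ)) •
        cfc (fun z : ℂ => Complex.exp (Complex.I * t * Complex.log z)) Δ) =
      ((2 * Real.exp (s / 2) : ℝ) : ℂ) •
        (cfc Real.sqrt Δ * Ring.inverse (Δ + (Real.exp s : ℂ) • (1 : A))) := by
  have hsa : IsSelfAdjoint Δ := .of_nonneg hΔpos
  have hspec {z : ℂ} (hz : z ∈ spectrum ℂ Δ) := exists_pos_of_mem_spectrum hΔpos hΔunit hz
  let k : ℝ → ℂ := fun t => (2 * Complex.exp (-(Complex.I * s * t))) /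
    ((Real.exp (π * t) + Real.exp (-(π * t)) : ℝ) : ℂ)
  let F : ℝ → ℂ → ℂ := fun t z => k t * Complex.exp (Complex.I * t * Complex.log z)
  have hden (t : ℝ) : ((Real.exp (π * t) + Real.exp (-(π * t)) : ℝ) : ℂ) ≠ 0 := by
    exact_mod_cast (add_pos (Real.exp_pos _) (Real.exp_pos _)).ne'
  have hk : Continuous k := by
    refine Continuous.div (by fun_prop) (by fun_prop) hden
  have hlog : ContinuousOn Complex.log (spectrum ℂ Δ) := by
    intro z hz
    obtain ⟨x, hx, rfl⟩ := hspec hz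
    exact (continuousAt_clog (Complex.ofReal_mem_slitPlane.2 hx)).continuousWithinAt
  have hF : ContinuousOn (Function.uncurry F) (Set.univ ×ˢ spectrum ℂ Δ) := by
    refine (hk.comp continuous_fst).continuousOn.mul (ContinuousOn.cexp ?_)
    refine ContinuousOn.mul (by fun_prop) ?_
    exact hlog.comp continuousOn_snd fun _ hp => hp.2
  have hFk (t x : ℝ) (hx : 0 < x) : F t x =
      2 * Complex.exp (Complex.I * (Real.log x - s : ℝ) * t) /
        ((Real.exp (π * t) + Real.exp (-(π * t)) : ℝ) : ℂ) := by
    simp only [F, k]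
    rw [div_mul_eq_mul_div, mul_assoc, ← Complex.exp_add, ← Complex.ofReal_log hx.le]
    push_cast
    ring_nf
  have hbound : ∀ᵐ t : ℝ, ∀ z ∈ spectrum ℂ Δ, ‖F t z‖ ≤ ‖k t‖ := by
    refine .of_forall fun t z hz => ?_
    obtain ⟨x, hx, rfl⟩ := hspec hz
    rw [norm_mul, ← Complex.ofReal_log hx.le, mul_assoc, ← Complex.ofReal_mul,
      Complex.norm_exp_I_mul_ofReal, mul_one]
  have hkint : HasFiniteIntegral (fun t => ‖k t‖) := by
    have := (integral_exp_div_exp_add_exp (-s)).1.norm.hasFiniteIntegral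
    convert! this using 5
    push_cast
    ring_nf
  have hcfc (t : ℝ) : cfc (F t) Δ =
      k t • cfc (fun z : ℂ => Complex.exp (Complex.I * t * Complex.log z)) Δ :=
    cfc_const_mul (k t) _ Δ (ContinuousOn.cexp (continuousOn_const.mul hlog))
  have hadd : cfc (fun z : ℂ => z + (Real.exp s : ℂ)) Δ = Δ + (Real.exp s : ℂ) • (1 : A) := by
    rw [cfc_add_const _ _ Δ, cfc_id' ℂ Δ, Algebra.algebraMap_eq_smul_one]
  have hne : ∀ z ∈ spectrum ℂ Δ, z + (Real.exp s : ℂ) ≠ 0 := by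
    intro z hz
    obtain ⟨x, hx, rfl⟩ := hspec hz
    exact_mod_cast (add_pos hx (Real.exp_pos s)).ne'
  refine ⟨?_, ?_, ?_⟩
  · exact (integrable_cfc F _ Δ hF hbound hkint).congr (.of_forall hcfc)
  · rw [← hadd]
    exact (isUnit_cfc_iff _ Δ).2 hne
  · rw [← integral_congr_ae (.of_forall hcfc), ← cfc_integral F _ Δ hF hbound hkint,
      cfc_real_eq_complex Real.sqrt, ← hadd, ← cfc_inv _ Δ hne]
    have hinv : ContinuousOn (fun z : ℂ => (z + (Real.exp s : ℂ))⁻¹) (spectrum ℂ Δ) :=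
      ContinuousOn.inv₀ (by fun_prop) hne
    rw [← cfc_mul _ _ Δ (by fun_prop) hinv, ← cfc_const_mul _ _ Δ (by fun_prop)]
    refine cfc_congr fun z hz => ?_
    obtain ⟨x, hx, rfl⟩ := hspec hz
    simp only [hFk _ x hx, Complex.ofReal_re]
    rw [(integral_exp_div_exp_add_exp _).2]
    exact_mod_cast inv_cosh_log_sub_half s hx
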